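/- arXiv:0704.1495 — 5 statements merged into one kernel-verified Lean document; each statement's English description precedes it below -/
import Mathlib

section
/- Let A be a 2×2 matrix with integer entries and |det A| = 1, and let v ∈ ℝ² be a nonzero vector with A v = λ v for some real λ with |λ| ≠ 1. Then the line ℝv meets the integer lattice ℤ² only at the origin: ℝv ∩ ℤ² = {0}. -/
/-- A real eigenvalue of a 2×2 integer matrix with a nonzero integer eigenvector is an integer
dividing the determinant. -/
theorem exists_int_eigenvalue_dvd_det (a b c d x y : ℤ) (hxy : x ≠ 0 ∨ y ≠ 0) (lam : ℝ)
    (hx : (a * x + b * y : ℝ) = lam * x) (hy : (c * x + d * y : ℝ) = lam * y) :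
    ∃ n : ℤ, (n : ℝ) = lam ∧ n ∣ a * d - b * c := by
  have hg : (Int.gcd x y : ℤ) ≠ 0 := by
    rw [Int.natCast_ne_zero, Ne, Int.gcd_eq_zero_iff]
    tauto
  have hbez := Int.gcd_eq_gcd_ab x y
  obtain ⟨k, hk⟩ := Int.gcd_dvd_left x y
  obtain ⟨l, hl⟩ := Int.gcd_dvd_right x y
  generalize (Int.gcd x y : ℤ) = g at *
  generalize Int.gcdA x y = r at *
  generalize Int.gcdB x y = s at *
  have hg_real : (g : ℝ) ≠ 0 := by exact_mod_cast hg
  have hk_real : (x : ℝ) = g * k := by exact_mod_cast hk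
  have hl_real : (y : ℝ) = g * l := by exact_mod_cast hl
  have hbez_real : (g : ℝ) = x * r + y * s := by exact_mod_cast hbez
  have hn : (((a * k + b * l) * r + (c * k + d * l) * s : ℤ) : ℝ) = lam := by
    apply mul_left_cancel₀ hg_real
    push_cast
    linear_combination r * hx + s * hy - (a * r + c * s) * hk_real - (b * r + d * s) * hl_real
      - lam * hbez_real
  generalize (a * k + b * l) * r + (c * k + d * l) * s = n at hn
  refine ⟨n, hn, a + d - n, ?_⟩
  subst hn
  have hx_int : a * x + b * y = n * x := by exact_mod_cast hx
  have hy_int : c * x + d * y = n * y := by exact_mod_cast hy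
  rcases hxy with h | h
  · apply mul_right_cancel₀ h
    linear_combination (d - n) * hx_int - b * hy_int
  · apply mul_right_cancel₀ h
    linear_combination (a - n) * hy_int - c * hx_int


/-- If `v` is a real eigenvector of a 2×2 integer matrix `A` with `|det A| = 1`,
for a real eigenvalue `λ` with `|λ| ≠ 1`, then the line `ℝ v` meets the integer
lattice `ℤ²` only at the origin. -/
theorem eigenline_irrational (A : Matrix (Fin 2) (Fin 2) ℤ) (hdet : |A.det| = 1)
    (v : Fin 2 → ℝ) (hv : v ≠ 0) (lam : ℝ)
    (heig : (A.map (fun z : ℤ => (z : ℝ))).mulVec v = lam • v) (hlam : |lam| ≠ 1) :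
    ∀ t : ℝ, (∃ q : Fin 2 → ℤ, (fun i => (q i : ℝ)) = t • v) → t • v = 0 := by
  rintro t ⟨q, hq⟩
  by_contra ht
  have hqv (i : Fin 2) : (q i : ℝ) = t * v i := congrFun hq i
  have hq_ne : q 0 ≠ 0 ∨ q 1 ≠ 0 := by
    by_contra! h
    apply ht
    rw [← hq]
    ext i
    fin_cases i <;> simp [h.1, h.2]
  have hrow (i : Fin 2) : (A i 0 * v 0 + A i 1 * v 1 : ℝ) = lam * v i := by
    simpa [Matrix.mulVec, dotProduct, Fin.sum_univ_two] using congrFun heig i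
  obtain ⟨n, hn, hdvd⟩ := exists_int_eigenvalue_dvd_det (A 0 0) (A 0 1) (A 1 0) (A 1 1)
    (q 0) (q 1) hq_ne lam
    (by rw [hqv, hqv]; linear_combination t * hrow 0)
    (by rw [hqv, hqv]; linear_combination t * hrow 1)
  rw [← Matrix.det_fin_two, ← dvd_abs, hdet, ← isUnit_iff_dvd_one] at hdvd
  apply hlam
  rw [← hn]
  exact_mod_cast Int.isUnit_iff_abs_eq.mp hdvd
end

section
/- Let A be a 2×2 integer matrix with det A = 1 and |tr A| > 2, and let e_u be an eigenvector of A whose eigenvalue λ_u satisfies |λ_u| > 1. Let u, v ∈ ℝ² be linearly independent and let E = K(u,v) = {a·u + b·v : a, b ∈ ℝ, ab ≥ 0}. If there exists λ_E > 1 with A·E ⊆ E and ‖Ax‖ ≥ λ_E‖x‖ for all x ∈ E, then e_u ∈ E. -/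
noncomputable section

/-- The Euclidean norm on `ℝ²`. -/
def en (x : Fin 2 → ℝ) : ℝ := Real.sqrt (x 0 ^ 2 + x 1 ^ 2)

/-- The cone spanned by the lines `ℝu` and `ℝv`. -/
def cone (u v : Fin 2 → ℝ) : Set (Fin 2 → ℝ) :=
  {x | ∃ a b : ℝ, 0 ≤ a * b ∧ x = a • u + b • v}

/-- Two linearly independent vectors of `ℝ²` have nonzero determinant. -/
lemma det_ne_zero_of_linearIndependent_pair {u v : Fin 2 → ℝ}
    (h : LinearIndependent ℝ ![u, v]) : u 0 * v 1 - u 1 * v 0 ≠ 0 := by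
  intro hD
  rw [LinearIndependent.pair_iff] at h
  obtain ⟨hv1, hu1⟩ := h (v 1) (-u 1) (by
    ext i; fin_cases i <;> simp <;> linarith)
  obtain ⟨hv0, hu0⟩ := h (v 0) (-u 0) (by
    ext i; fin_cases i <;> simp <;> linarith)
  have hu : u = 0 := by
    ext i; fin_cases i <;> simp <;> linarith
  have := (h 1 0 (by simp [hu])).1
  norm_num at this

/-- An eigenvector with coordinates of opposite signs of a `2 × 2` matrix of determinant one
whose off-diagonal and lower right entries are nonnegative has an eigenvalue of absolute value at
most one. -/
lemma abs_eigenvalue_le_one_of_nonneg {p q r s x y l : ℝ} (hq : 0 ≤ q) (hr : 0 ≤ r)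
    (hs : 0 ≤ s) (hdet : p * s - q * r = 1) (hxy : x * y < 0) (hx : p * x + r * y = l * x)
    (hy : q * x + s * y = l * y) : |l| ≤ 1 := by
  have hx0 : x ≠ 0 := by rintro rfl; simp at hxy
  have hy0 : y ≠ 0 := by rintro rfl; simp at hxy
  have hx2 : 0 < x ^ 2 := by positivity
  have hy2 : 0 < y ^ 2 := by positivity
  have hlp : l ≤ p := by
    have h : (p - l) * x ^ 2 = r * -(x * y) := by linear_combination x * hx
    have : 0 ≤ (p - l) * x ^ 2 := h ▸ mul_nonneg hr (by linarith)
    linarith [nonneg_of_mul_nonneg_left this hx2]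
  have hls : l ≤ s := by
    have h : (s - l) * y ^ 2 = q * -(x * y) := by linear_combination y * hy
    have : 0 ≤ (s - l) * y ^ 2 := h ▸ mul_nonneg hq (by linarith)
    linarith [nonneg_of_mul_nonneg_left this hy2]
  have hchar : l * (p + s - l) = 1 := by
    refine mul_right_cancel₀ hxy.ne ?_
    linear_combination x * y * hdet + (l - s) * y * hx + r * y * hy
  have hl : 0 < l := pos_of_mul_pos_left (by rw [hchar]; norm_num) (by linarith)
  rw [abs_of_pos hl]
  nlinarith

/-- If a real `2 × 2` matrix of determinant one preserves the double cone `{a * b ≥ 0}`, then all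
its entries have the same sign. -/
lemma nonneg_or_nonpos_of_preserves_cone {p q r s : ℝ} (hdet : p * s - q * r = 1)
    (h : ∀ a b : ℝ, 0 ≤ a * b → 0 ≤ (a * p + b * r) * (a * q + b * s)) :
    (0 ≤ p ∧ 0 ≤ q ∧ 0 ≤ r ∧ 0 ≤ s) ∨ (p ≤ 0 ∧ q ≤ 0 ∧ r ≤ 0 ∧ s ≤ 0) := by
  have hpq : 0 ≤ p * q := by simpa using h 1 0 (by simp)
  have hrs : 0 ≤ r * s := by simpa using h 0 1 (by simp)
  have hmix : 0 < (r + s) * (p + q) := by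
    by_contra! hneg
    have h₁ := h (-(r + s)) (p + q) (by linarith)
    have h₂ : (-(r + s) * p + (p + q) * r) * (-(r + s) * q + (p + q) * s) = -1 := by
      linear_combination (-(p * s - q * r) - 1) * hdet
    linarith
  rcases mul_nonneg_iff.mp hpq with ⟨hp, hq⟩ | ⟨hp, hq⟩ <;>
    rcases mul_nonneg_iff.mp hrs with ⟨hr, hs⟩ | ⟨hr, hs⟩
  · exact Or.inl ⟨hp, hq, hr, hs⟩
  · nlinarith
  · nlinarith
  · exact Or.inr ⟨hp, hq, hr, hs⟩

/-- An eigenvector with coordinates of opposite signs of a `2 × 2` matrix of determinant one that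
preserves the double cone `{a * b ≥ 0}` has an eigenvalue of absolute value at most one. -/
lemma abs_eigenvalue_le_one_of_preserves_cone {p q r s x y l : ℝ} (hdet : p * s - q * r = 1)
    (h : ∀ a b : ℝ, 0 ≤ a * b → 0 ≤ (a * p + b * r) * (a * q + b * s)) (hxy : x * y < 0)
    (hx : p * x + r * y = l * x) (hy : q * x + s * y = l * y) : |l| ≤ 1 := by
  rcases nonneg_or_nonpos_of_preserves_cone hdet h with ⟨-, hq, hr, hs⟩ | ⟨-, hq, hr, hs⟩
  · exact abs_eigenvalue_le_one_of_nonneg hq hr hs hdet hxy hx hy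
  · rw [← abs_neg]
    exact abs_eigenvalue_le_one_of_nonneg (p := -p) (neg_nonneg.mpr hq)
      (neg_nonneg.mpr hr) (neg_nonneg.mpr hs) (by linarith) hxy (by linarith) (by linarith)

/-- Coordinates in a basis of `ℝ²` are unique. -/
lemma coord_eq_of_linearIndependent_pair {u v : Fin 2 → ℝ} (h : LinearIndependent ℝ ![u, v])
    {a b c d : ℝ} (hab : a • u + b • v = c • u + d • v) : a = c ∧ b = d := by
  rw [LinearIndependent.pair_iff] at h
  have := h (a - c) (b - d) (by rw [sub_smul, sub_smul, sub_add_sub_comm, hab, sub_self])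
  exact ⟨by linarith [this.1], by linarith [this.2]⟩

/-- An expansion cone for a hyperbolic toral automorphism must contain the
unstable eigendirection. -/
theorem expansion_cone_contains_unstable (A : Matrix (Fin 2) (Fin 2) ℤ)
    (hdet : A.det = 1) (htr : 2 < |A.trace|)
    (lamu : ℝ) (hlamu : 1 < |lamu|) (eu : Fin 2 → ℝ) (heu : eu ≠ 0)
    (heig : (A.map (fun z : ℤ => (z : ℝ))).mulVec eu = lamu • eu)
    (u v : Fin 2 → ℝ) (hind : LinearIndependent ℝ ![u, v])
    (lamE : ℝ) (hlamE : 1 < lamE)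
    (hmap : ∀ x ∈ cone u v, (A.map (fun z : ℤ => (z : ℝ))).mulVec x ∈ cone u v)
    (hexp : ∀ x ∈ cone u v, lamE * en x ≤ en ((A.map (fun z : ℤ => (z : ℝ))).mulVec x)) :
    eu ∈ cone u v := by
  have hD := det_ne_zero_of_linearIndependent_pair hind
  set B : Matrix (Fin 2) (Fin 2) ℝ := A.map (fun z : ℤ => (z : ℝ)) with hB
  have hBdet : B 0 0 * B 1 1 - B 0 1 * B 1 0 = 1 := by
    rw [Matrix.det_fin_two] at hdet
    simp only [hB, Matrix.map_apply]
    exact_mod_cast hdet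
  obtain ⟨p, q, -, hu⟩ := hmap u ⟨1, 0, by simp, by simp⟩
  obtain ⟨r, s, -, hv⟩ := hmap v ⟨0, 1, by simp, by simp⟩
  have hcomb (a b : ℝ) :
      B.mulVec (a • u + b • v) = (a * p + b * r) • u + (a * q + b * s) • v := by
    rw [Matrix.mulVec_add, Matrix.mulVec_smul, Matrix.mulVec_smul, hu, hv]
    module
  have hpres (a b : ℝ) (hab : 0 ≤ a * b) : 0 ≤ (a * p + b * r) * (a * q + b * s) := by
    obtain ⟨c, d, hcd, h⟩ := hmap _ ⟨a, b, hab, rfl⟩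
    rw [hcomb] at h
    obtain ⟨rfl, rfl⟩ := coord_eq_of_linearIndependent_pair hind h
    exact hcd
  have hpqrs : p * s - q * r = 1 := by
    have hu0 := congrFun hu 0
    have hu1 := congrFun hu 1
    have hv0 := congrFun hv 0
    have hv1 := congrFun hv 1
    simp only [Matrix.mulVec, dotProduct, Fin.sum_univ_two, Pi.add_apply, Pi.smul_apply,
      smul_eq_mul] at hu0 hu1 hv0 hv1
    refine mul_right_cancel₀ hD ?_
    have key : (p * u 0 + q * v 0) * (r * u 1 + s * v 1)
        - (p * u 1 + q * v 1) * (r * u 0 + s * v 0) = u 0 * v 1 - u 1 * v 0 := by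
      rw [← hu0, ← hu1, ← hv0, ← hv1]
      linear_combination (u 0 * v 1 - u 1 * v 0) * hBdet
    linear_combination key
  obtain ⟨x, y, hxy⟩ : ∃ x y : ℝ, eu = x • u + y • v := by
    refine ⟨(eu 0 * v 1 - eu 1 * v 0) / (u 0 * v 1 - u 1 * v 0),
      (u 0 * eu 1 - u 1 * eu 0) / (u 0 * v 1 - u 1 * v 0), ?_⟩
    ext i
    simp only [Pi.add_apply, Pi.smul_apply, smul_eq_mul]
    rw [div_mul_eq_mul_div, div_mul_eq_mul_div, ← add_div, eq_div_iff hD]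
    fin_cases i <;> simp only [Fin.zero_eta, Fin.mk_one] <;> ring
  refine ⟨x, y, ?_, hxy⟩
  by_contra! hneg
  rw [hxy, hcomb, smul_add, smul_smul, smul_smul] at heig
  obtain ⟨hx, hy⟩ := coord_eq_of_linearIndependent_pair hind heig
  have := abs_eigenvalue_le_one_of_preserves_cone hpqrs hpres hneg
    (by linarith : p * x + r * y = lamu * x) (by linarith)
  linarith
end
end

section
/- Let A and B be 2×2 integer matrices with determinant 1 all of whose entries are positive (hence ≥ 1). Let E := {(x₁,x₂) ∈ ℝ² : x₁x₂ ≥ 0} (the union of the closed first and third quadrants) and C := {(x₁,x₂) ∈ ℝ² : x₁x₂ ≤ 0}. Then there exist λ_E > 1 and 0 < λ_C < 1 such that for each M ∈ {A,B}: M·E ⊆ E and ‖Mx‖ ≥ λ_E‖x‖ for all x ∈ E, and M⁻¹·C ⊆ C and ‖M⁻¹x‖ ≥ λ_C⁻¹‖x‖ for all x ∈ C. -/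
noncomputable section

/-- A matrix with entries at least `1` preserves the union of the first and third quadrants. -/
lemma quadrants_invariant {a b c d x y : ℝ} (ha : 1 ≤ a) (hb : 1 ≤ b) (hc : 1 ≤ c) (hd : 1 ≤ d)
    (h : 0 ≤ x * y) : 0 ≤ (a * x + b * y) * (c * x + d * y) := by
  have : (a * x + b * y) * (c * x + d * y) =
      a * c * x ^ 2 + b * d * y ^ 2 + (a * d + b * c) * (x * y) := by ring
  rw [this]
  positivity

/-- A matrix with entries at least `1` expands the first and third quadrants by `√2`. -/
lemma sqrt_two_mul_sqrt_le {a b c d x y : ℝ} (ha : 1 ≤ a) (hb : 1 ≤ b) (hc : 1 ≤ c)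
    (hd : 1 ≤ d) (h : 0 ≤ x * y) :
    √2 * √(x ^ 2 + y ^ 2) ≤ √((a * x + b * y) ^ 2 + (c * x + d * y) ^ 2) := by
  rw [← Real.sqrt_mul (by norm_num)]
  apply Real.sqrt_le_sqrt
  have hsplit : (a * x + b * y) ^ 2 + (c * x + d * y) ^ 2 =
      (a ^ 2 + c ^ 2) * x ^ 2 + (b ^ 2 + d ^ 2) * y ^ 2 + 2 * (a * b + c * d) * (x * y) := by ring
  have hac : 2 ≤ a ^ 2 + c ^ 2 := by nlinarith
  have hbd : 2 ≤ b ^ 2 + d ^ 2 := by nlinarith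
  have hx := mul_le_mul_of_nonneg_right hac (sq_nonneg x)
  have hy := mul_le_mul_of_nonneg_right hbd (sq_nonneg y)
  have hxy : 0 ≤ 2 * (a * b + c * d) * (x * y) := by positivity
  linarith

/-- For positive-entry matrices in SL(2,ℤ), the union of the closed first and third
quadrants is an expansion cone, and its complementary cone a contraction cone. -/
theorem positive_matrices_quadrant_cones (A B : Matrix (Fin 2) (Fin 2) ℤ)
    (hdA : A.det = 1) (hdB : B.det = 1)
    (hposA : ∀ i j, 0 < A i j) (hposB : ∀ i j, 0 < B i j) :
    ∃ lamE > (1 : ℝ), ∃ lamC : ℝ, 0 < lamC ∧ lamC < 1 ∧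
      ∀ M : Matrix (Fin 2) (Fin 2) ℤ, M = A ∨ M = B →
        ((∀ x : Fin 2 → ℝ, 0 ≤ x 0 * x 1 →
            0 ≤ (M.map (fun z : ℤ => (z : ℝ))).mulVec x 0 *
                (M.map (fun z : ℤ => (z : ℝ))).mulVec x 1 ∧
            lamE * en x ≤ en ((M.map (fun z : ℤ => (z : ℝ))).mulVec x)) ∧
          (∀ x : Fin 2 → ℝ, x 0 * x 1 ≤ 0 →
            ((M.map (fun z : ℤ => (z : ℝ)))⁻¹).mulVec x 0 *
              ((M.map (fun z : ℤ => (z : ℝ)))⁻¹).mulVec x 1 ≤ 0 ∧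
            lamC⁻¹ * en x ≤ en (((M.map (fun z : ℤ => (z : ℝ)))⁻¹).mulVec x))) := by
  have hone : (1 : ℝ) < √2 := Real.one_lt_sqrt_two
  refine ⟨√2, hone, (√2)⁻¹, by positivity, inv_lt_one_of_one_lt₀ hone, fun M hM => ?_⟩
  have hpos : ∀ i j, (1 : ℝ) ≤ M i j := by
    intro i j
    have : 0 < M i j := by rcases hM with rfl | rfl <;> apply_assumption
    exact_mod_cast this
  have hdet : (M 0 0 : ℝ) * M 1 1 - M 0 1 * M 1 0 = 1 := by
    have : M.det = 1 := by rcases hM with rfl | rfl <;> assumption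
    rw [Matrix.det_fin_two] at this
    exact_mod_cast this
  have hinv : (M.map (fun z : ℤ => (z : ℝ)))⁻¹ =
      !![(M 1 1 : ℝ), -M 0 1; -M 1 0, M 0 0] := by
    rw [Matrix.inv_def, Matrix.adjugate_fin_two, Matrix.det_fin_two]
    simp [hdet]
  refine ⟨fun x hx => ?_, fun x hx => ?_⟩
  · simp only [en, Matrix.mulVec, dotProduct, Fin.sum_univ_two, Matrix.map_apply]
    exact ⟨quadrants_invariant (hpos _ _) (hpos _ _) (hpos _ _) (hpos _ _) hx,
      sqrt_two_mul_sqrt_le (hpos _ _) (hpos _ _) (hpos _ _) (hpos _ _) hx⟩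
  · have hx' : 0 ≤ x 0 * -x 1 := by linarith
    have hcone := quadrants_invariant (hpos 1 1) (hpos 0 1) (hpos 1 0) (hpos 0 0) hx'
    have hnorm := sqrt_two_mul_sqrt_le (hpos 1 1) (hpos 0 1) (hpos 1 0) (hpos 0 0) hx'
    rw [hinv, inv_inv]
    simp only [en, Matrix.mulVec, dotProduct, Fin.sum_univ_two, Matrix.of_apply,
      Matrix.cons_val_zero, Matrix.cons_val_one]
    refine ⟨by linarith, ?_⟩
    convert hnorm using 2 <;> ring_nf
end
end

section
/- Let Ã₀ and Ã₁ be 2×2 integer matrices with determinant 1, and let C, E ⊆ ℝ² with C ∩ E = {0} satisfy, for each i ∈ {0,1}: (a) ‖Ã_i q‖ ≤ λ_C ‖q‖ whenever Ã_i q ∈ C; (b) q ∉ C implies Ã_i q ∉ C; (c) q ∈ E implies Ã_i q ∈ E and ‖Ã_i q‖ ≥ λ_E ‖q‖, where 0 < λ_C < 1 < λ_E. Set λ := max(λ_C, λ_E⁻¹) < 1, and for ω ∈ {0,1}^ℕ write Ã_ω^n := Ã_{ω(n−1)}⋯Ã_{ω(0)}. Then for every ω ∈ {0,1}^ℕ and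 every q ∈ (C ∩ ℤ²) \ {0} there exists a unique integer N = N_ω(q) ≥ 0 (the contraction time) such that Ã_ω^n q ∈ C for all 0 ≤ n ≤ N and Ã_ω^{N+1} q ∉ C; moreover N_ω(q) ≤ ln‖q‖ / ln λ⁻¹, and 1 ≤ ‖Ã_ω^n q‖ ≤ λⁿ ‖q‖ for all 0 ≤ n ≤ N. -/
noncomputable section

/-- The random product `Ã_ω^n := Ã_{ω(n-1)} ⋯ Ã_{ω(0)}`. -/
def mprod (A0 A1 : Matrix (Fin 2) (Fin 2) ℝ) (ω : ℕ → Fin 2) : ℕ → Matrix (Fin 2) (Fin 2) ℝ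
  | 0 => 1
  | n + 1 => (if ω n = 0 then A0 else A1) * mprod A0 A1 ω n

theorem one_le_en_intCast {z : Fin 2 → ℤ} (hz : z ≠ 0) :
    1 ≤ en (fun i => (z i : ℝ)) := by
  rw [en, Real.one_le_sqrt]
  have hpos : 0 < z 0 ^ 2 + z 1 ^ 2 := by
    by_contra! h
    have h0 : z 0 = 0 := pow_eq_zero_iff two_ne_zero |>.1
      (by nlinarith [sq_nonneg (z 0), sq_nonneg (z 1)])
    have h1 : z 1 = 0 := pow_eq_zero_iff two_ne_zero |>.1
      (by nlinarith [sq_nonneg (z 0), sq_nonneg (z 1)])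
    exact hz (funext (Fin.forall_fin_two.2 ⟨h0, h1⟩))
  exact_mod_cast Int.add_one_le_of_lt hpos

/-- Along the orbit of a nonzero integer vector under integer matrices of determinant one,
every vector is a nonzero integer vector. -/
theorem exists_intCast_eq_mprod_mulVec {A0 A1 : Matrix (Fin 2) (Fin 2) ℤ}
    (hd0 : A0.det = 1) (hd1 : A1.det = 1) (ω : ℕ → Fin 2) {q : Fin 2 → ℤ} (hq : q ≠ 0) (n : ℕ) :
    ∃ z : Fin 2 → ℤ, z ≠ 0 ∧
      (mprod (A0.map (fun z : ℤ => (z : ℝ))) (A1.map (fun z : ℤ => (z : ℝ))) ω n).mulVec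
        (fun i => (q i : ℝ)) = fun i => (z i : ℝ) := by
  induction n with
  | zero => exact ⟨q, hq, by simp [mprod]⟩
  | succ n ih =>
    obtain ⟨z, hz, h⟩ := ih
    have key : ∀ M : Matrix (Fin 2) (Fin 2) ℤ, M.det = 1 →
        M.mulVec z ≠ 0 ∧ (M.map (fun z : ℤ => (z : ℝ))).mulVec (fun i => (z i : ℝ)) =
          fun i => ((M.mulVec z i : ℤ) : ℝ) := by
      refine fun M hM => ⟨fun h0 => hz ?_, ?_⟩
      · exact Matrix.eq_zero_of_mulVec_eq_zero (by simp [hM]) h0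
      · ext i
        simp [Matrix.mulVec, dotProduct]
    simp only [mprod, ← Matrix.mulVec_mulVec, h]
    split_ifs
    · exact ⟨_, key A0 hd0⟩
    · exact ⟨_, key A1 hd1⟩

/-- A sequence of reals that are at least one and that contracts by a factor `r < 1` as long as
it satisfies `P` satisfies `P` up to a unique last time, which is at most logarithmic. -/
theorem exists_last_time_of_contracting {P : ℕ → Prop} {f : ℕ → ℝ} {r : ℝ}
    (hr0 : 0 < r) (hr1 : r < 1) (hf : ∀ n, 1 ≤ f n) (hP : P 0)
    (hstep : ∀ n, P (n + 1) → f (n + 1) ≤ r * f n) :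
    ∃ N : ℕ, ((∀ n ≤ N, P n) ∧ ¬ P (N + 1)) ∧
      (∀ N' : ℕ, ((∀ n ≤ N', P n) ∧ ¬ P (N' + 1)) → N' = N) ∧
      (N : ℝ) ≤ Real.log (f 0) / Real.log r⁻¹ ∧
      ∀ n ≤ N, 1 ≤ f n ∧ f n ≤ r ^ n * f 0 := by
  classical
  have hbound : ∀ n, (∀ m ≤ n, P m) → f n ≤ r ^ n * f 0 := by
    intro n
    induction n with
    | zero => simp
    | succ n ih =>
      intro h
      calc f (n + 1) ≤ r * f n := hstep n (h _ le_rfl)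
        _ ≤ r * (r ^ n * f 0) := by
          gcongr
          exact ih fun m hm => h m (hm.trans n.le_succ)
        _ = r ^ (n + 1) * f 0 := by ring
  have hf0 : 0 < f 0 := one_pos.trans_le (hf 0)
  have hex : ∃ n, ¬ P n := by
    by_contra! h
    obtain ⟨n, hn⟩ := exists_pow_lt_of_lt_one (inv_pos.2 hf0) hr1
    have h1 : r ^ n * f 0 < 1 := by rwa [← lt_div_iff₀ hf0, one_div]
    exact absurd ((hf n).trans (hbound n fun m _ => h m)) h1.not_ge
  obtain ⟨N, hN⟩ : ∃ N, Nat.find hex = N + 1 :=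
    Nat.exists_eq_succ_of_ne_zero fun h => Nat.find_spec hex (by rwa [h])
  have hin : ∀ n ≤ N, P n := fun n hn => not_not.1 (Nat.find_min hex (by omega))
  have hout : ¬ P (N + 1) := hN ▸ Nat.find_spec hex
  refine ⟨N, ⟨hin, hout⟩, ?_, ?_, fun n hn => ⟨hf n, hbound n fun m hm => hin m (hm.trans hn)⟩⟩
  · rintro N' ⟨h1, h2⟩
    rcases lt_trichotomy N' N with h | h | h
    · exact absurd (hin _ h) h2
    · exact h
    · exact absurd (h1 _ h) hout
  · rw [le_div_iff₀ (Real.log_pos ((one_lt_inv₀ hr0).2 hr1)), Real.log_inv]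
    have h := Real.log_nonneg ((hf N).trans (hbound N hin))
    rw [Real.log_mul (by positivity) hf0.ne', Real.log_pow] at h
    linarith

/-- Existence, uniqueness and bounds for the contraction time of a nonzero integer
vector in the contraction cone. -/
theorem contraction_time (A0 A1 : Matrix (Fin 2) (Fin 2) ℤ)
    (hd0 : A0.det = 1) (hd1 : A1.det = 1)
    (C E : Set (Fin 2 → ℝ)) (hdisj : C ∩ E = {0})
    (lamC lamE : ℝ) (hlamC0 : 0 < lamC) (hlamC1 : lamC < 1) (hlamE : 1 < lamE)
    (ha : ∀ M : Matrix (Fin 2) (Fin 2) ℤ, M = A0 ∨ M = A1 → ∀ q : Fin 2 → ℝ,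
      (M.map (fun z : ℤ => (z : ℝ))).mulVec q ∈ C →
        en ((M.map (fun z : ℤ => (z : ℝ))).mulVec q) ≤ lamC * en q)
    (hb : ∀ M : Matrix (Fin 2) (Fin 2) ℤ, M = A0 ∨ M = A1 → ∀ q : Fin 2 → ℝ,
      q ∉ C → (M.map (fun z : ℤ => (z : ℝ))).mulVec q ∉ C)
    (hc : ∀ M : Matrix (Fin 2) (Fin 2) ℤ, M = A0 ∨ M = A1 → ∀ q : Fin 2 → ℝ,
      q ∈ E → (M.map (fun z : ℤ => (z : ℝ))).mulVec q ∈ E ∧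
        lamE * en q ≤ en ((M.map (fun z : ℤ => (z : ℝ))).mulVec q)) :
    ∀ ω : ℕ → Fin 2, ∀ q : Fin 2 → ℤ, q ≠ 0 → (fun i => (q i : ℝ)) ∈ C →
      ∃ N : ℕ,
        ((∀ n ≤ N, (mprod (A0.map (fun z : ℤ => (z : ℝ))) (A1.map (fun z : ℤ => (z : ℝ))) ω n).mulVec
            (fun i => (q i : ℝ)) ∈ C) ∧
          (mprod (A0.map (fun z : ℤ => (z : ℝ))) (A1.map (fun z : ℤ => (z : ℝ))) ω (N + 1)).mulVec
            (fun i => (q i : ℝ)) ∉ C) ∧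
        (∀ N' : ℕ,
          ((∀ n ≤ N', (mprod (A0.map (fun z : ℤ => (z : ℝ))) (A1.map (fun z : ℤ => (z : ℝ))) ω n).mulVec
              (fun i => (q i : ℝ)) ∈ C) ∧
            (mprod (A0.map (fun z : ℤ => (z : ℝ))) (A1.map (fun z : ℤ => (z : ℝ))) ω (N' + 1)).mulVec
              (fun i => (q i : ℝ)) ∉ C) → N' = N) ∧
        (N : ℝ) ≤ Real.log (en (fun i => (q i : ℝ))) / Real.log (max lamC lamE⁻¹)⁻¹ ∧
        (∀ n ≤ N,
          1 ≤ en ((mprod (A0.map (fun z : ℤ => (z : ℝ))) (A1.map (fun z : ℤ => (z : ℝ))) ω n).mulVec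
              (fun i => (q i : ℝ))) ∧
          en ((mprod (A0.map (fun z : ℤ => (z : ℝ))) (A1.map (fun z : ℤ => (z : ℝ))) ω n).mulVec
              (fun i => (q i : ℝ)))
            ≤ (max lamC lamE⁻¹) ^ n * en (fun i => (q i : ℝ))) := by
  intro ω q hq hqC
  have hr0 : 0 < max lamC lamE⁻¹ := lt_max_of_lt_left hlamC0
  have hr1 : max lamC lamE⁻¹ < 1 := max_lt hlamC1 (inv_lt_one_of_one_lt₀ hlamE)
  set v : ℕ → Fin 2 → ℝ := fun n =>
    (mprod (A0.map (fun z : ℤ => (z : ℝ))) (A1.map (fun z : ℤ => (z : ℝ))) ω n).mulVec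
      (fun i => (q i : ℝ)) with hv
  have hv0 : v 0 = fun i => (q i : ℝ) := Matrix.one_mulVec _
  have hlen : ∀ n, 1 ≤ en (v n) := by
    intro n
    obtain ⟨z, hz, h⟩ := exists_intCast_eq_mprod_mulVec hd0 hd1 ω hq n
    simp only [hv, h]
    exact one_le_en_intCast hz
  have hstep : ∀ n, v (n + 1) ∈ C → en (v (n + 1)) ≤ max lamC lamE⁻¹ * en (v n) := by
    intro n hn
    refine le_trans ?_ (mul_le_mul_of_nonneg_right (le_max_left lamC lamE⁻¹)
      (Real.sqrt_nonneg _ : 0 ≤ en (v n)))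
    simp only [hv, mprod, ← Matrix.mulVec_mulVec] at hn ⊢
    split_ifs at hn ⊢
    · exact ha A0 (Or.inl rfl) _ hn
    · exact ha A1 (Or.inr rfl) _ hn
  have main := exists_last_time_of_contracting (P := fun n => v n ∈ C) (f := fun n => en (v n))
    hr0 hr1 hlen (by simpa only [hv0] using hqC) hstep
  simp only [hv0] at main
  exact main
end
end

section
/- Let C = K(v₁,v₂) and E = K(u₁,u₂) be cones spanned by two lines in ℝ² (with v₁,v₂ linearly independent and u₁,u₂ linearly independent) such that C ∩ E = {0}. Then there exists a constant K > 0 such that for all x ∈ C and y ∈ E with x + y ∈ C, one has ‖y‖ ≤ K‖x‖ and ‖x‖ ≤ K‖x+y‖. -/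
noncomputable section

lemma smul_mem_cone {u v x : Fin 2 → ℝ} (c : ℝ) (hx : x ∈ cone u v) : c • x ∈ cone u v := by
  obtain ⟨a, b, hab, rfl⟩ := hx
  exact ⟨c * a, c * b, by nlinarith [mul_nonneg (sq_nonneg c) hab], by simp [smul_smul]⟩

lemma isClosed_cone {u v : Fin 2 → ℝ} (h : LinearIndependent ℝ ![u, v]) :
    IsClosed (cone u v) := by
  have hD : u 0 * v 1 - u 1 * v 0 ≠ 0 := by
    have := (Matrix.linearIndependent_rows_iff_isUnit (A := Matrix.of ![u, v])).1 h
    rw [Matrix.isUnit_iff_isUnit_det, Matrix.det_fin_two, isUnit_iff_ne_zero] at this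
    simpa using this
  have hset : cone u v =
      {x | 0 ≤ (x 0 * v 1 - x 1 * v 0) * (u 0 * x 1 - u 1 * x 0)} := by
    ext x
    constructor
    · rintro ⟨a, b, hab, rfl⟩
      have := mul_nonneg hab (sq_nonneg (u 0 * v 1 - u 1 * v 0))
      refine this.trans_eq ?_
      simp only [Pi.add_apply, Pi.smul_apply, smul_eq_mul]
      ring
    · intro hx
      refine ⟨(x 0 * v 1 - x 1 * v 0) / (u 0 * v 1 - u 1 * v 0),
        (u 0 * x 1 - u 1 * x 0) / (u 0 * v 1 - u 1 * v 0), ?_, ?_⟩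
      · rw [div_mul_div_comm]
        exact div_nonneg hx (mul_self_nonneg _)
      · ext i
        fin_cases i <;>
        · simp only [Pi.add_apply, Pi.smul_apply, smul_eq_mul, Fin.zero_eta, Fin.mk_one]
          rw [div_mul_eq_mul_div, div_mul_eq_mul_div, ← add_div, eq_div_iff hD]
          ring
  rw [hset]
  exact isClosed_le (by fun_prop) (by fun_prop)

lemma norm_le_en (x : Fin 2 → ℝ) : ‖x‖ ≤ en x := by
  refine (pi_norm_le_iff_of_nonneg (Real.sqrt_nonneg _)).2 fun i => ?_
  rw [Real.norm_eq_abs]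
  apply Real.abs_le_sqrt
  fin_cases i <;> simp [sq_nonneg]

lemma en_le_two_mul_norm (x : Fin 2 → ℝ) : en x ≤ 2 * ‖x‖ := by
  have h (i : Fin 2) : x i ^ 2 ≤ ‖x‖ ^ 2 := by
    rw [← sq_abs, ← Real.norm_eq_abs]
    gcongr
    exact norm_le_pi_norm x i
  exact Real.sqrt_le_iff.2 ⟨by positivity, by nlinarith [h 0, h 1, sq_nonneg ‖x‖]⟩

lemma exists_norm_le_mul_norm_sub {C E : Set (Fin 2 → ℝ)} (hC : IsClosed C) (hE : IsClosed E)
    (hCs : ∀ c : ℝ, ∀ x ∈ C, c • x ∈ C) (hEs : ∀ c : ℝ, ∀ x ∈ E, c • x ∈ E)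
    (hCE : C ∩ E = {0}) :
    ∃ K > (0 : ℝ), ∀ z ∈ C, ∀ y ∈ E, ‖y‖ ≤ K * ‖y - z‖ := by
  have hdisj : Disjoint (Metric.sphere (0 : Fin 2 → ℝ) 1 ∩ E) C := by
    rw [Set.disjoint_left]
    rintro y ⟨hy1, hyE⟩ hyC
    have hy0 : y ∈ ({0} : Set (Fin 2 → ℝ)) := hCE ▸ ⟨hyC, hyE⟩
    rw [Set.mem_singleton_iff] at hy0
    simp [hy0] at hy1
  obtain ⟨r, hr, hlt⟩ :=
    Metric.exists_pos_forall_lt_edist ((isCompact_sphere _ _).inter_right hE) hC hdisj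
  refine ⟨(r : ℝ)⁻¹, by positivity, fun z hz y hy => ?_⟩
  rcases eq_or_ne y 0 with rfl | hy0
  · simp only [norm_zero]
    positivity
  have hpos : 0 < ‖y‖ := norm_pos_iff.2 hy0
  have h := hlt (‖y‖⁻¹ • y) ⟨by simp [norm_smul, hpos.ne'], hEs _ y hy⟩ (‖y‖⁻¹ • z) (hCs _ z hz)
  rw [edist_nndist, ENNReal.coe_lt_coe, ← NNReal.coe_lt_coe, coe_nndist, dist_eq_norm,
    ← smul_sub, norm_smul, norm_inv, norm_norm, inv_mul_eq_div, lt_div_iff₀ hpos] at h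
  rw [inv_mul_eq_div, le_div_iff₀ (by exact_mod_cast hr)]
  linarith

/-- Elementary geometric estimate for two transversal cones: if `x ∈ C`, `y ∈ E`
and `x + y ∈ C`, then `‖y‖ ≤ K‖x‖` and `‖x‖ ≤ K‖x + y‖`. -/
theorem transversal_cones_estimate (v₁ v₂ u₁ u₂ : Fin 2 → ℝ)
    (hv : LinearIndependent ℝ ![v₁, v₂]) (hu : LinearIndependent ℝ ![u₁, u₂])
    (hdisj : cone v₁ v₂ ∩ cone u₁ u₂ = {0}) :
    ∃ K > (0 : ℝ), ∀ x ∈ cone v₁ v₂, ∀ y ∈ cone u₁ u₂, x + y ∈ cone v₁ v₂ →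
      en y ≤ K * en x ∧ en x ≤ K * en (x + y) := by
  obtain ⟨K, hK, h⟩ := exists_norm_le_mul_norm_sub (isClosed_cone hv) (isClosed_cone hu)
    (fun c _ hx => smul_mem_cone c hx) (fun c _ hx => smul_mem_cone c hx) hdisj
  refine ⟨2 * (K + 1), by positivity, fun x hx y hy hxy => ⟨?_, ?_⟩⟩
  · have hyx : ‖y‖ ≤ K * ‖x‖ := by simpa using h _ hxy y hy
    nlinarith [en_le_two_mul_norm y, norm_le_en x, norm_nonneg x]
  · have hyxy : ‖y‖ ≤ K * ‖x + y‖ := by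
      have hneg := h x hx (-y) (by simpa using smul_mem_cone (-1) hy)
      rwa [← neg_add', norm_neg, norm_neg, add_comm y x] at hneg
    have hx' : ‖x‖ ≤ ‖x + y‖ + ‖y‖ := by simpa using norm_sub_le (x + y) y
    nlinarith [en_le_two_mul_norm x, norm_le_en (x + y), norm_nonneg (x + y)]
end
end
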